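/- Let a triangle ABC and a quadrilateral DEFG be disjoint straight-edge cycles in R^3 with vertices in general position. If the boundary of the quadrilateral meets the flat triangular disk bounded by ABC in exactly two points lying on adjacent edges DE and EF of the quadrilateral, then the two cycles form a trivial link. -/

import Mathlib

open scoped Classical

noncomputable section

/-- Points of `ℝ³`. -/
abbrev E3 := EuclideanSpace ℝ (Fin 3)

/-- The determinant of the three vectors `a, b, c` of `ℝ³`. -/
def det3 (a b c : E3) : ℝ :=
  a 0 * (b 1 * c 2 - b 2 * c 1) - a 1 * (b 0 * c 2 - b 2 * c 0) +
    a 2 * (b 0 * c 1 - b 1 * c 0)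

/-- The open flat triangular disk with vertices `A`, `B`, `C`. -/
def OpenTri (A B C : E3) : Set E3 :=
  {x | ∃ a b c : ℝ, 0 < a ∧ 0 < b ∧ 0 < c ∧ a + b + c = 1 ∧
    x = a • A + b • B + c • C}

/-- The segment `XY` pierces the open triangular disk `ABC`. -/
def Pierces (A B C X Y : E3) : Prop :=
  (openSegment ℝ X Y ∩ OpenTri A B C).Nonempty

/-- The signed intersection of the segment `XY` with the triangle `ABC`:
`±1` if `XY` pierces the open disk of `ABC` (the sign recording on which side of
the plane of `ABC` the point `X` lies), and `0` otherwise. -/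
def edgeSign (A B C X Y : E3) : ℤ :=
  if Pierces A B C X Y then
    (if 0 < det3 (B - A) (C - A) (X - A) then 1 else -1) else 0

/-- The linking number of the straight-edge triangle `ABC` with the straight-edge
quadrilateral `DEFG`: the signed count of intersections of the edges of the
quadrilateral with the flat disk bounded by the triangle. -/
def lkTriQuad (A B C D E F G : E3) : ℤ :=
  edgeSign A B C D E + edgeSign A B C E F + edgeSign A B C F G + edgeSign A B C G D

/-- Seven points in general position: no four of them are coplanar. -/
def GenPos7 (v : Fin 7 → E3) : Prop :=
  ∀ i j k l : Fin 7, i ≠ j → i ≠ k → i ≠ l → j ≠ k → j ≠ l → k ≠ l →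
    AffineIndependent ℝ ![v i, v j, v k, v l]

/-- The closed polygonal triangle (1-complex) with vertices `A`, `B`, `C`. -/
def cycle3 (A B C : E3) : Set E3 :=
  segment ℝ A B ∪ segment ℝ B C ∪ segment ℝ C A

/-- The closed polygonal quadrilateral with vertices `D`, `E`, `F`, `G`. -/
def cycle4 (D E F G : E3) : Set E3 :=
  segment ℝ D E ∪ segment ℝ E F ∪ segment ℝ F G ∪ segment ℝ G D

/-- A two-component link `(K, L)` in `ℝ³` is split (trivial): there is an ambient
isotopy of `ℝ³` (a continuous family of homeomorphisms starting at the identity,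
with continuously varying inverses) moving `K` and `L` to opposite sides of a
plane. -/
def SplitLink (K L : Set E3) : Prop :=
  ∃ H : ℝ → (E3 ≃ₜ E3),
    Continuous (fun q : ℝ × E3 => H q.1 q.2) ∧
    Continuous (fun q : ℝ × E3 => (H q.1).symm q.2) ∧
    (∀ x, H 0 x = x) ∧
    (∀ x ∈ K, H 1 x 0 < 0) ∧ (∀ x ∈ L, 0 < H 1 x 0)

/-- Pushing along `w` with a speed that is monotone along `w` is an isotopy. -/
theorem exists_push (φ : E3 → ℝ) (w : E3) (hc : Continuous φ) (h0 : ∀ x, 0 ≤ φ x)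
    (hm : ∀ (x : E3) (s : ℝ), 0 ≤ s → φ x ≤ φ (x + s • w)) :
    ∃ H : ℝ → (E3 ≃ₜ E3),
      Continuous (fun q : ℝ × E3 => H q.1 q.2) ∧
      Continuous (fun q : ℝ × E3 => (H q.1).symm q.2) ∧
      (∀ x, H 0 x = x) ∧ (∀ x, H 1 x = x + φ x • w) := by
  have hanti : ∀ (y : E3) (s₁ s₂ : ℝ), s₁ ≤ s₂ → φ (y - s₂ • w) ≤ φ (y - s₁ • w) := by
    intro y s₁ s₂ h
    have := hm (y - s₂ • w) (s₂ - s₁) (by linarith)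
    have e : y - s₂ • w + (s₂ - s₁) • w = y - s₁ • w := by module
    rwa [e] at this
  have hex : ∀ q : ℝ × E3, ∃ s : ℝ, s = max q.1 0 * φ (q.2 - s • w) := by
    rintro ⟨t, y⟩
    have hT : 0 ≤ max t 0 := le_max_right _ _
    have hcont : ContinuousOn (fun s : ℝ => s - max t 0 * φ (y - s • w))
        (Set.Icc 0 (max t 0 * φ y)) := by fun_prop
    have h1 : 0 ≤ max t 0 * φ y := mul_nonneg hT (h0 y)
    have := intermediate_value_Icc h1 hcont
    have hmem : (0 : ℝ) ∈ Set.Icc ((fun s : ℝ => s - max t 0 * φ (y - s • w)) 0)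
        ((fun s : ℝ => s - max t 0 * φ (y - s • w)) (max t 0 * φ y)) := by
      constructor
      · simp only [zero_smul, sub_zero]; linarith
      · simp only
        have := hanti y 0 _ h1
        rw [zero_smul, sub_zero] at this
        have := mul_le_mul_of_nonneg_left this hT
        linarith
    obtain ⟨s, -, hs⟩ := this hmem
    exact ⟨s, by simp only at hs; linarith⟩
  choose σ hσ using hex
  have key : ∀ (t : ℝ) (y : E3) (s : ℝ) (q : ℝ × E3), s = max t 0 * φ (y - s • w) →
      |σ q - s| ≤ |max q.1 0 * φ (q.2 - s • w) - max t 0 * φ (y - s • w)| := by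
    intro t y s q hs
    have hT : 0 ≤ max q.1 0 := le_max_right _ _
    have h1 := hσ q
    rcases le_total s (σ q) with h | h
    · have := mul_le_mul_of_nonneg_left (hanti q.2 _ _ h) hT
      rw [abs_of_nonneg (by linarith)]
      refine le_trans ?_ (le_abs_self _)
      linarith
    · have := mul_le_mul_of_nonneg_left (hanti q.2 _ _ h) hT
      rw [abs_of_nonpos (by linarith)]
      refine le_trans ?_ (neg_le_abs _)
      linarith
  have huniq : ∀ (t : ℝ) (y : E3) (s : ℝ), s = max t 0 * φ (y - s • w) → σ (t, y) = s := by
    intro t y s hs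
    have := key t y s (t, y) hs
    simp only [sub_self, abs_zero] at this
    have := abs_nonpos_iff.1 this
    linarith
  have hσc : Continuous σ := by
    rw [continuous_iff_continuousAt]
    rintro ⟨t, y⟩
    rw [ContinuousAt, tendsto_iff_dist_tendsto_zero]
    have hlim : Filter.Tendsto (fun q : ℝ × E3 =>
        |max q.1 0 * φ (q.2 - σ (t, y) • w) - max t 0 * φ (y - σ (t, y) • w)|)
        (nhds (t, y)) (nhds 0) := by
      have : Continuous (fun q : ℝ × E3 =>
        |max q.1 0 * φ (q.2 - σ (t, y) • w) - max t 0 * φ (y - σ (t, y) • w)|) := by fun_prop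
      have := this.tendsto (t, y)
      simpa using this
    refine squeeze_zero (fun _ => dist_nonneg) (fun q => ?_) hlim
    rw [Real.dist_eq]
    exact key t y _ q (hσ (t, y))
  refine ⟨fun t =>
    { toFun := fun x => x + (max t 0 * φ x) • w
      invFun := fun y => y - σ (t, y) • w
      left_inv := ?_
      right_inv := ?_
      continuous_toFun := by fun_prop
      continuous_invFun := by fun_prop }, ?_, ?_, ?_, ?_⟩
  · intro x
    have : σ (t, x + (max t 0 * φ x) • w) = max t 0 * φ x := by
      apply huniq
      simp
    simp [this]
  · intro y
    have := hσ (t, y)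
    simp only at this
    simp only
    rw [← this]; simp
  · change Continuous (fun q : ℝ × E3 => q.2 + (max q.1 0 * φ q.2) • w)
    fun_prop
  · change Continuous (fun q : ℝ × E3 => q.2 - σ (q.1, q.2) • w)
    fun_prop
  · intro x
    change x + (max 0 0 * φ x) • w = x
    simp
  · intro x
    change x + (max 1 0 * φ x) • w = _
    simp

theorem SplitLink.of_isotopy {K L : Set E3} (H : ℝ → (E3 ≃ₜ E3))
    (h1 : Continuous (fun q : ℝ × E3 => H q.1 q.2))
    (h2 : Continuous (fun q : ℝ × E3 => (H q.1).symm q.2))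
    (h3 : ∀ x, H 0 x = x) (h : SplitLink (H 1 '' K) (H 1 '' L)) : SplitLink K L := by
  obtain ⟨J, j1, j2, j3, j4, j5⟩ := h
  refine ⟨fun t => (H t).trans (J t), ?_, ?_, ?_, ?_, ?_⟩
  · exact j1.comp (continuous_fst.prodMk h1)
  · exact h2.comp (continuous_fst.prodMk j2)
  · intro x; simp [h3, j3]
  · intro x hx; exact j4 _ ⟨x, hx, rfl⟩
  · intro x hx; exact j5 _ ⟨x, hx, rfl⟩

theorem SplitLink.of_push {K L S : Set E3} (w : E3) (hw : w ≠ 0) (hK : IsCompact K)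
    (hL : IsCompact L) (hS : IsClosed S) (hne : S.Nonempty) (hKS : K ⊆ S)
    (hSL : ∀ x ∈ L, x ∉ S) (hSw : ∀ x ∈ S, ∀ s : ℝ, 0 ≤ s → x + s • w ∈ S)
    (h : ∀ K' : Set E3, IsCompact K' →
      (∃ c : ℝ, (∀ x ∈ K', c < inner ℝ w x) ∧ (∀ x ∈ L, inner ℝ w x < c)) → SplitLink K' L) :
    SplitLink K L := by
  obtain ⟨ε, hε, hεL⟩ : ∃ ε : ℝ, 0 < ε ∧ ∀ x ∈ L, ε ≤ Metric.infDist x S := by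
    rcases L.eq_empty_or_nonempty with rfl | hLn
    · exact ⟨1, one_pos, by simp⟩
    · obtain ⟨x, hx, hmin⟩ := hL.exists_isMinOn hLn
        (Metric.continuous_infDist_pt S).continuousOn
      exact ⟨_, (hS.notMem_iff_infDist_pos hne).1 (hSL x hx), fun y hy => hmin hy⟩
  have hic : Continuous (fun x : E3 => inner ℝ w x) := by fun_prop
  obtain ⟨b, hb⟩ := (hK.image hic).bddBelow
  obtain ⟨B, hB⟩ := (hL.image hic).bddAbove
  have hww : 0 < inner ℝ w w := real_inner_self_pos.2 hw
  obtain ⟨M, hM0, hM⟩ : ∃ M : ℝ, 0 ≤ M ∧ B + 1 < b + M * inner ℝ w w := by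
    refine ⟨(|B + 1 - b| + 1) / inner ℝ w w, by positivity, ?_⟩
    rw [div_mul_cancel₀ _ hww.ne']
    have := le_abs_self (B + 1 - b)
    linarith
  obtain ⟨H, H1, H2, H3, H4⟩ := exists_push
    (fun x => M * max 0 (1 - Metric.infDist x S / ε)) w
    (by have := Metric.continuous_infDist_pt S; fun_prop)
    (fun x => by positivity)
    (by
      intro x s hs
      have : Metric.infDist (x + s • w) S ≤ Metric.infDist x S := by
        refine (Metric.le_infDist hne).2 ?_
        intro y hy
        have := Metric.infDist_le_dist_of_mem (x := x + s • w) (hSw y hy s hs)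
        simpa using this
      gcongr)
  refine SplitLink.of_isotopy H H1 H2 H3 ?_
  have eL : H 1 '' L = L := by
    have : ∀ x ∈ L, H 1 x = x := by
      intro x hx
      rw [H4]
      have : 1 - Metric.infDist x S / ε ≤ 0 := by
        have := (one_le_div hε).2 (hεL x hx)
        linarith
      rw [max_eq_left this]; simp
    rw [Set.image_congr this]; simp
  rw [eL]
  refine h _ (hK.image (H 1).continuous) ⟨B + 1, ?_, ?_⟩
  · rintro _ ⟨x, hx, rfl⟩
    rw [H4, Metric.infDist_zero_of_mem (hKS hx)]
    have := hb ⟨x, hx, rfl⟩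
    simp only at this
    rw [inner_add_right, inner_smul_right]
    simp only [zero_div, sub_zero, max_eq_right zero_le_one, mul_one]
    linarith
  · intro x hx
    have := hB ⟨x, hx, rfl⟩
    simp only at this
    linarith

theorem SplitLink.of_translate {K L : Set E3} (c : ℝ) (hK : ∀ x ∈ K, x 0 < c)
    (hL : ∀ x ∈ L, c < x 0) : SplitLink K L := by
  refine ⟨fun t => Homeomorph.addRight (t • EuclideanSpace.single 0 (-c)), ?_, ?_, ?_, ?_, ?_⟩
  · simp only [Homeomorph.coe_addRight]; fun_prop
  · simp only [Homeomorph.addRight_symm, Homeomorph.coe_addRight]; fun_prop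
  · simp
  · intro x hx; simpa using hK x hx
  · intro x hx; simpa using hL x hx

theorem SplitLink.of_sep_pair {K L : Set E3} (f w : E3) (hw : w ≠ 0) (hf : 0 ≤ inner ℝ f w)
    (hne : K.Nonempty) (hK : IsCompact K) (hL : IsCompact L)
    (hs : ∃ c : ℝ, (∀ x ∈ K, c < inner ℝ f x) ∧ (∀ x ∈ L, inner ℝ f x < c))
    (h : ∀ K' : Set E3, IsCompact K' →
      (∃ c : ℝ, (∀ x ∈ K', c < inner ℝ w x) ∧ (∀ x ∈ L, inner ℝ w x < c)) → SplitLink K' L) :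
    SplitLink K L := by
  obtain ⟨c, hc1, hc2⟩ := hs
  refine SplitLink.of_push (S := {x | c ≤ inner ℝ f x}) w hw hK hL
    (isClosed_le continuous_const (by fun_prop)) ?_ (fun x hx => (hc1 x hx).le)
    (fun x hx => not_le.2 (hc2 x hx)) ?_ h
  · obtain ⟨x, hx⟩ := hne
    exact ⟨x, (hc1 x hx).le⟩
  · intro x hx s hs
    simp only [Set.mem_ofPred_eq, inner_add_right, inner_smul_right] at hx ⊢
    have := mul_nonneg hs hf
    linarith

theorem SplitLink.of_sep {K L : Set E3} (f : E3)
    (hK : IsCompact K) (hL : IsCompact L)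
    (hs : ∃ c : ℝ, (∀ x ∈ K, c < inner ℝ f x) ∧ (∀ x ∈ L, inner ℝ f x < c)) :
    SplitLink K L := by
  have last : ∀ K' : Set E3, IsCompact K' → (∃ c : ℝ, (∀ x ∈ K', c <
      inner ℝ (EuclideanSpace.single 0 (-1) : E3) x) ∧
      (∀ x ∈ L, inner ℝ (EuclideanSpace.single 0 (-1) : E3) x < c)) → SplitLink K' L := by
    rintro K' - ⟨c, h1, h2⟩
    refine SplitLink.of_translate (-c) (fun x hx => ?_) (fun x hx => ?_)
    · have := h1 x hx
      simp [EuclideanSpace.inner_single_left] at this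
      linarith
    · have := h2 x hx
      simp [EuclideanSpace.inner_single_left] at this
      linarith
  have emp : ∀ K' : Set E3, ¬ K'.Nonempty → SplitLink K' L := by
    intro K' hK'
    rw [Set.not_nonempty_iff_eq_empty] at hK'
    subst hK'
    have hic : Continuous (fun x : E3 => x 0) := by fun_prop
    obtain ⟨B, hB⟩ := (hL.image hic).bddBelow
    refine SplitLink.of_translate (B - 1) (by simp) (fun x hx => ?_)
    have := hB ⟨x, hx, rfl⟩
    simp only at this
    linarith
  have mid : ∀ a : ℝ, a ≠ 0 → 0 ≤ a * f 1 → SplitLink K L := by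
    intro a ha haf
    by_cases hne : K.Nonempty
    · refine SplitLink.of_sep_pair f (EuclideanSpace.single 1 a) (by simpa using ha) ?_ hne hK hL
        hs ?_
      · simpa [EuclideanSpace.inner_single_right] using haf
      · intro K' hK' hs'
        by_cases hne' : K'.Nonempty
        · refine SplitLink.of_sep_pair _ (EuclideanSpace.single 0 (-1)) (by simp) ?_ hne' hK' hL
            hs' last
          simp [EuclideanSpace.inner_single_right]
        · exact emp _ hne'
    · exact emp _ hne
  rcases le_total 0 (f 1) with h | h
  · exact mid 1 one_ne_zero (by linarith)
  · exact mid (-1) (by norm_num) (by linarith)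

/-- A plane through three of four affinely independent points. -/
theorem exists_plane {a b c d : E3} (h : AffineIndependent ℝ ![a, b, c, d]) :
    ∃ (l : E3 →ₗ[ℝ] ℝ) (k : ℝ), l a = k ∧ l b = k ∧ l c = k ∧ l d = k + 1 := by
  have hd : d ∉ affineSpan ℝ {a, b, c} := by
    have := h.notMem_affineSpan_sdiff 3 Set.univ
    have e : (![a, b, c, d] '' (Set.univ \ {3})) = {a, b, c} := by
      ext x
      simp only [Set.mem_image, Set.mem_sdiff, Set.mem_univ, true_and, Set.mem_singleton_iff,
        Fin.exists_fin_succ, Set.mem_insert_iff]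
      simp [Fin.ext_iff, eq_comm]
    rw [e] at this
    simpa using this
  have hd' : d - a ∉ Submodule.span ℝ {b - a, c - a} := by
    intro hmem
    apply hd
    rw [Submodule.mem_span_pair] at hmem
    obtain ⟨s, t, hst⟩ := hmem
    have ha : a ∈ affineSpan ℝ {a, b, c} := mem_affineSpan ℝ (by simp)
    have hb : b ∈ affineSpan ℝ {a, b, c} := mem_affineSpan ℝ (by simp)
    have hc : c ∈ affineSpan ℝ {a, b, c} := mem_affineSpan ℝ (by simp)
    have h1 := AffineSubspace.vadd_mem_of_mem_direction
      ((affineSpan ℝ {a, b, c}).direction.add_mem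
        ((affineSpan ℝ {a, b, c}).direction.smul_mem s (AffineSubspace.vsub_mem_direction hb ha))
        ((affineSpan ℝ {a, b, c}).direction.smul_mem t (AffineSubspace.vsub_mem_direction hc ha)))
      ha
    have e : (s • (b -ᵥ a) + t • (c -ᵥ a)) +ᵥ a = d := by
      simp only [vsub_eq_sub, vadd_eq_add, hst]; abel
    rwa [e] at h1
  obtain ⟨g, hg, hgm⟩ := Submodule.exists_dual_map_eq_bot_of_notMem hd' inferInstance
  have hz : ∀ x ∈ Submodule.span ℝ {b - a, c - a}, g x = 0 := by
    intro x hx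
    have : g x ∈ Submodule.map g (Submodule.span ℝ {b - a, c - a}) := ⟨x, hx, rfl⟩
    rw [hgm] at this
    simpa using this
  have hb := hz (b - a) (Submodule.subset_span (by simp))
  have hc := hz (c - a) (Submodule.subset_span (by simp))
  rw [map_sub] at hb hc hg
  refine ⟨(g d - g a)⁻¹ • g, (g d - g a)⁻¹ * g a, ?_, ?_, ?_, ?_⟩
  · simp
  · simp [sub_eq_zero.1 hb]
  · simp [sub_eq_zero.1 hc]
  · have : (g d - g a)⁻¹ * (g d - g a) = 1 := inv_mul_cancel₀ hg
    simp only [LinearMap.smul_apply, smul_eq_mul]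
    linarith

theorem edge_avoid {a b c d e f X Y : E3} (h1 : AffineIndependent ℝ ![a, b, e, c])
    (h2 : AffineIndependent ℝ ![a, b, e, d]) (h3 : AffineIndependent ℝ ![a, b, e, f])
    (hX : X ∈ openSegment ℝ d e) (hY : Y ∈ openSegment ℝ e f)
    (hX' : X ∈ convexHull ℝ {a, b, c}) (hY' : Y ∈ convexHull ℝ {a, b, c}) :
    ∀ x ∈ segment ℝ X Y, x ∉ segment ℝ a b := by
  have hnX : X ∉ segment ℝ a b := by
    obtain ⟨l, k, l1, l2, l3, l4⟩ := exists_plane h2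
    rintro ⟨s, t, hs, ht, hst, rfl⟩
    obtain ⟨s', t', hs', ht', hst', he⟩ := hX
    have := congrArg l he
    simp only [map_add, map_smul, smul_eq_mul, l1, l2, l3, l4] at this
    have e1 : s' * (k + 1) + t' * k = k + s' := by linear_combination k * hst'
    have e2 : s * k + t * k = k := by linear_combination k * hst
    linarith
  have hnY : Y ∉ segment ℝ a b := by
    obtain ⟨l, k, l1, l2, l3, l4⟩ := exists_plane h3
    rintro ⟨s, t, hs, ht, hst, rfl⟩
    obtain ⟨s', t', hs', ht', hst', he⟩ := hY
    have := congrArg l he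
    simp only [map_add, map_smul, smul_eq_mul, l1, l2, l3, l4] at this
    have e1 : s' * k + t' * (k + 1) = k + t' := by linear_combination k * hst'
    have e2 : s * k + t * k = k := by linear_combination k * hst
    linarith
  obtain ⟨q, k, q1, q2, -, q4⟩ := exists_plane h1
  have hseg : ∀ x ∈ segment ℝ a b, q x = k := by
    rintro x ⟨s, t, hs, ht, hst, rfl⟩
    simp only [map_add, map_smul, smul_eq_mul, q1, q2]
    linear_combination k * hst
  have hpos : ∀ x ∈ convexHull ℝ {a, b, c}, x ∉ segment ℝ a b → k < q x := by
    intro x hx hn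
    have e : ({a, b, c} : Set E3) = {c, a, b} := by
      ext y; simp only [Set.mem_insert_iff, Set.mem_singleton_iff]; tauto
    rw [e, convexHull_insert (by simp), convexHull_pair, mem_convexJoin] at hx
    obtain ⟨c', hc', y, hy, s, t, hs, ht, hst, rfl⟩ := hx
    rw [Set.mem_singleton_iff] at hc'
    subst hc'
    have hs0 : s ≠ 0 := by
      rintro rfl
      apply hn
      have : t = 1 := by linarith
      simpa [this] using hy
    have : 0 < s := lt_of_le_of_ne hs (Ne.symm hs0)
    simp only [map_add, map_smul, smul_eq_mul, q4, hseg y hy]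
    have e1 : s * (k + 1) + t * k = k + s := by linear_combination k * hst
    linarith
  have pX := hpos X hX' hnX
  have pY := hpos Y hY' hnY
  rintro x ⟨s, t, hs, ht, hst, rfl⟩ hx
  have := hseg _ hx
  simp only [map_add, map_smul, smul_eq_mul] at this
  rcases hs.eq_or_lt with h | h
  · have : t = 1 := by linarith
    subst this; subst h; linarith
  · have i1 : s * k < s * q X := by gcongr
    have i2 : t * k ≤ t * q Y := by gcongr
    have e2 : s * k + t * k = k := by linear_combination k * hst
    linarith

theorem isCompact_seg (a b : E3) : IsCompact (segment ℝ a b) := by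
  rw [← convexHull_pair]
  exact (Set.toFinite {a, b}).isCompact_convexHull ℝ

/-- Points of the lower edge `DE` on or above the plane project into `XY`. -/
theorem proj_edge {D E X W : E3} {l : E3 →ₗ[ℝ] ℝ} {k : ℝ} (hE : l E = k + 1)
    (hX : X ∈ openSegment ℝ D E) (hlX : l X = k) :
    l D < k ∧ ∀ x ∈ segment ℝ D E, k ≤ l x →
      l x ≤ k + 1 ∧ x - (l x - k) • (E - (1 / 2 : ℝ) • (X + W)) ∈ segment ℝ X W := by
  obtain ⟨s, t, hs, ht, hst, rfl⟩ := hX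
  simp only [map_add, map_smul, smul_eq_mul, hE] at hlX
  have hD : s * (k - l D) = t := by linear_combination k * hst - hlX
  have hD' : l D < k := by
    by_contra hcon
    have : s * (k - l D) ≤ 0 := mul_nonpos_of_nonneg_of_nonpos hs.le (by linarith)
    linarith
  refine ⟨hD', ?_⟩
  rintro x ⟨a, b, ha, hb, hab, rfl⟩ hx
  obtain ⟨q, hq⟩ : ∃ q, q = l (a • D + b • E) - k := ⟨_, rfl⟩
  have hq' : q = b - a * (k - l D) := by
    rw [hq]; simp only [map_add, map_smul, smul_eq_mul, hE]; linear_combination k * hab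
  have hq0 : 0 ≤ q := by linarith
  have hq1 : q ≤ 1 := by
    have := mul_nonneg ha (sub_nonneg.2 hD'.le)
    linarith
  refine ⟨by linarith, ?_⟩
  rw [← hq]
  refine ⟨1 - q / 2, q / 2, by linarith, by linarith, by ring, ?_⟩
  have hsa : (1 - q) * s = a := by
    rw [hq']; linear_combination a * hst + a * hD - s * hab
  have hta : (1 - q) * t + q = b := by
    have : (1 - q) * (s + t) = (1 - q) * 1 := by rw [hst]
    linarith
  rw [← hsa, ← hta]
  module

/-- An upper crossing of the plane can be separated from the disk. -/
theorem sep_edge {C : Set E3} (hC : IsCompact C) (hcv : Convex ℝ C) (D G : E3)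
    (l : E3 →ₗ[ℝ] ℝ) (k : ℝ) (hD : l D < k) (hn : ∀ x ∈ segment ℝ D G, x ∉ C) :
    ∃ (f : E3 →L[ℝ] ℝ) (c : ℝ), (∀ x ∈ C, f x ≤ c) ∧
      ∀ x ∈ segment ℝ D G, l x = k → c < f x := by
  by_cases h : ∃ P ∈ segment ℝ D G, l P = k
  · obtain ⟨P, hP, hPk⟩ := h
    obtain ⟨f, u, v, h1, h2, h3⟩ := geometric_hahn_banach_compact_closed hcv hC
      (convex_singleton P) isClosed_singleton (Set.disjoint_singleton_right.2 (hn P hP))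
    refine ⟨f, u, fun x hx => (h1 x hx).le, ?_⟩
    intro x hx hxk
    have : x = P := by
      obtain ⟨s, t, hs, ht, hst, rfl⟩ := hP
      obtain ⟨s', t', hs', ht', hst', rfl⟩ := hx
      simp only [map_add, map_smul, smul_eq_mul] at hPk hxk
      obtain rfl : s = 1 - t := by linarith
      obtain rfl : s' = 1 - t' := by linarith
      have e : (t' - t) * (l G - l D) = 0 := by linarith
      rcases mul_eq_zero.1 e with e | e
      · rw [sub_eq_zero.1 e]
      · exfalso
        have : l G = l D := by linarith
        rw [this] at hPk
        linarith
    rw [this]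
    exact h2.trans (h3 P rfl)
  · push Not at h
    exact ⟨0, 0, by simp, fun x hx hk => absurd hk (h x hx)⟩

theorem exists_dir (l f g : E3 →ₗ[ℝ] ℝ) : ∃ w : E3, w ≠ 0 ∧ l w = 0 ∧ f w ≤ 0 ∧ g w ≤ 0 := by
  have : ∃ w ∈ LinearMap.ker (l.prod f), w ≠ 0 := by
    apply Submodule.exists_mem_ne_zero_of_ne_bot
    apply LinearMap.ker_ne_bot_of_finrank_lt
    simp
  obtain ⟨w, hw, hw0⟩ := this
  replace hw : l w = 0 ∧ f w = 0 := Prod.mk_eq_zero.1 (LinearMap.mem_ker.1 hw)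
  rcases le_total (g w) 0 with h | h
  · exact ⟨w, hw0, hw.1, hw.2.le, h⟩
  · exact ⟨-w, by simpa using hw0, by simp [hw.1], by simp [hw.2], by simpa using h⟩

/-- The main geometric argument. -/
theorem split_core {A B C D E F G X Y : E3} (l p : E3 →ₗ[ℝ] ℝ) (k kp : ℝ)
    (lA : l A = k) (lB : l B = k) (lC : l C = k) (lE : l E = k + 1)
    (pD : p D = kp) (pE : p E = kp) (pF : p F = kp) (pG : p G = kp + 1)
    (hX : X ∈ openSegment ℝ D E) (hY : Y ∈ openSegment ℝ E F)
    (hav : ∀ x ∈ segment ℝ X Y, x ∉ cycle3 A B C)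
    (hmeet : cycle4 D E F G ∩ convexHull ℝ {A, B, C} = {X, Y}) :
    SplitLink (cycle3 A B C) (cycle4 D E F G) := by
  have hXC : X ∈ convexHull ℝ {A, B, C} := by
    have : X ∈ ({X, Y} : Set E3) := by simp
    rw [← hmeet] at this; exact this.2
  have hYC : Y ∈ convexHull ℝ {A, B, C} := by
    have : Y ∈ ({X, Y} : Set E3) := by simp
    rw [← hmeet] at this; exact this.2
  have hlc : Continuous l := l.continuous_of_finiteDimensional
  have hull_l : ∀ x ∈ convexHull ℝ {A, B, C}, l x = k := by
    have : convexHull ℝ {A, B, C} ⊆ {x | l x = k} := by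
      apply convexHull_min
      · rintro x (rfl | rfl | rfl) <;> assumption
      · exact convex_hyperplane l.isLinear k
    exact fun x hx => this hx
  have hCcomp : IsCompact (convexHull ℝ {A, B, C}) :=
    (Set.toFinite {A, B, C}).isCompact_convexHull ℝ
  have hKC : cycle3 A B C ⊆ convexHull ℝ {A, B, C} := by
    have hcv := convex_convexHull ℝ ({A, B, C} : Set E3)
    have hA : A ∈ convexHull ℝ {A, B, C} := subset_convexHull ℝ _ (by simp)
    have hB : B ∈ convexHull ℝ {A, B, C} := subset_convexHull ℝ _ (by simp)
    have hC : C ∈ convexHull ℝ {A, B, C} := subset_convexHull ℝ _ (by simp)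
    rintro x ((hx | hx) | hx)
    · exact hcv.segment_subset hA hB hx
    · exact hcv.segment_subset hB hC hx
    · exact hcv.segment_subset hC hA hx
  have hKcomp : IsCompact (cycle3 A B C) :=
    ((isCompact_seg _ _).union (isCompact_seg _ _)).union (isCompact_seg _ _)
  have hLcomp : IsCompact (cycle4 D E F G) :=
    (((isCompact_seg _ _).union (isCompact_seg _ _)).union (isCompact_seg _ _)).union
      (isCompact_seg _ _)
  have lX := hull_l X hXC
  have lY := hull_l Y hYC
  obtain ⟨lD, hDE⟩ := proj_edge (W := Y) lE hX lX
  rw [openSegment_symm] at hY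
  obtain ⟨lF, hFE⟩ := proj_edge (W := X) lE hY lY
  have pX : p X = kp := by
    obtain ⟨s, t, hs, ht, hst, rfl⟩ := hX
    simp only [map_add, map_smul, smul_eq_mul, pD, pE]; linear_combination kp * hst
  have pY : p Y = kp := by
    obtain ⟨s, t, hs, ht, hst, rfl⟩ := hY
    simp only [map_add, map_smul, smul_eq_mul, pF, pE]; linear_combination kp * hst
  -- on the upper path only the endpoints lie in the plane of `D, E, F`
  have hDG : ∀ x ∈ segment ℝ D G, p x = kp → x = D := by
    rintro x ⟨s, t, hs, ht, hst, rfl⟩ hx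
    simp only [map_add, map_smul, smul_eq_mul, pD, pG] at hx
    have : t = 0 := by linear_combination hx - kp * hst
    subst this
    have : s = 1 := by linarith
    subst this; simp
  have hFG : ∀ x ∈ segment ℝ F G, p x = kp → x = F := by
    rintro x ⟨s, t, hs, ht, hst, rfl⟩ hx
    simp only [map_add, map_smul, smul_eq_mul, pF, pG] at hx
    have : t = 0 := by linear_combination hx - kp * hst
    subst this
    have : s = 1 := by linarith
    subst this; simp
  have hpU : ∀ x ∈ segment ℝ D G ∪ segment ℝ F G, p x = kp → l x < k := by
    rintro x (hx | hx) h
    · rw [hDG x hx h]; exact lD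
    · rw [hFG x hx h]; exact lF
  have hUL : segment ℝ D G ∪ segment ℝ F G ⊆ cycle4 D E F G := by
    rintro x (hx | hx)
    · rw [segment_symm] at hx
      exact Or.inr hx
    · exact Or.inl (Or.inr hx)
  have hUC : ∀ x ∈ segment ℝ D G ∪ segment ℝ F G, x ∉ convexHull ℝ {A, B, C} := by
    intro x hx hxC
    have : x ∈ cycle4 D E F G ∩ convexHull ℝ {A, B, C} := ⟨hUL hx, hxC⟩
    rw [hmeet] at this
    rcases this with rfl | rfl
    · have := hpU _ hx pX; linarith
    · have := hpU _ hx pY; linarith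
  -- the projection along `u`
  obtain ⟨u, hu⟩ : ∃ u : E3, u = E - (1 / 2 : ℝ) • (X + Y) := ⟨_, rfl⟩
  have lu : l u = 1 := by
    rw [hu]; simp only [map_sub, map_add, map_smul, smul_eq_mul, lE, lX, lY]; ring
  have pu : p u = 0 := by
    rw [hu]; simp only [map_sub, map_add, map_smul, smul_eq_mul, pE, pX, pY]; ring
  let π : E3 → E3 := fun x => x - (l x - k) • u
  have hπc : Continuous π := by fun_prop
  have hπu : ∀ (x : E3) (s : ℝ), π (x + s • -u) = π x := by
    intro x s
    simp only [π, map_add, map_smul, map_neg, lu, smul_eq_mul]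
    module
  have hup : ∀ x ∈ segment ℝ D E ∪ segment ℝ E F, k ≤ l x →
      l x ≤ k + 1 ∧ π x ∈ segment ℝ X Y := by
    rintro x (hx | hx) h
    · have := hDE x hx h
      rwa [← hu] at this
    · rw [segment_symm] at hx
      have := hFE x hx h
      rwa [add_comm Y X, ← hu, segment_symm] at this
  let Z : Set E3 := cycle3 A B C ∪ π '' ((segment ℝ D G ∪ segment ℝ F G) ∩ {x | k ≤ l x})
  have hZcomp : IsCompact Z := by
    refine hKcomp.union (IsCompact.image ?_ hπc)
    exact ((isCompact_seg _ _).union (isCompact_seg _ _)).inter_right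
      (isClosed_le continuous_const hlc)
  have hAK : A ∈ cycle3 A B C := Or.inl (Or.inl (left_mem_segment ℝ A B))
  have hZne : Z.Nonempty := ⟨A, Or.inl hAK⟩
  have hZXY : ∀ z ∈ segment ℝ X Y, z ∉ Z := by
    rintro z hz (hzK | ⟨x, ⟨hxU, hxl⟩, rfl⟩)
    · exact hav z hz hzK
    · have h1 : p (π x) = kp := by
        obtain ⟨s, t, hs, ht, hst, he⟩ := hz
        rw [← he]
        simp only [map_add, map_smul, smul_eq_mul, pX, pY]; linear_combination kp * hst
      simp only [π, map_sub, map_smul, pu, smul_eq_mul, mul_zero, sub_zero] at h1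
      have := hpU x hxU h1
      exact absurd hxl (not_le.2 this)
  obtain ⟨ε, hε, hεXY⟩ : ∃ ε : ℝ, 0 < ε ∧ ∀ x ∈ segment ℝ X Y, ε ≤ Metric.infDist x Z := by
    obtain ⟨x, hx, hmin⟩ := (isCompact_seg X Y).exists_isMinOn ⟨X, left_mem_segment ℝ X Y⟩
      (Metric.continuous_infDist_pt Z).continuousOn
    exact ⟨_, (hZcomp.isClosed.notMem_iff_infDist_pos hZne).1 (hZXY x hx), fun y hy => hmin hy⟩
  -- first isotopy: push the corner `E` below the disk
  obtain ⟨H, H1, H2, H3, H4⟩ := exists_push (fun x => (2 / ε) * Metric.infDist (π x) Z) (-u)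
    (by have := (Metric.continuous_infDist_pt Z).comp hπc
        exact continuous_const.mul this)
    (fun x => mul_nonneg (by positivity) Metric.infDist_nonneg)
    (by intro x s _; rw [hπu])
  refine SplitLink.of_isotopy H H1 H2 H3 ?_
  have hfixZ : ∀ x, π x ∈ Z → H 1 x = x := by
    intro x hx
    rw [H4, Metric.infDist_zero_of_mem hx]; simp
  have eK : H 1 '' cycle3 A B C = cycle3 A B C := by
    have : ∀ x ∈ cycle3 A B C, H 1 x = x := by
      intro x hx
      apply hfixZ
      have : π x = x := by simp [π, hull_l x (hKC hx)]
      rw [this]; exact Or.inl hx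
    rw [Set.image_congr this]; simp
  rw [eK]
  have hlH : ∀ x, l (H 1 x) = l x - (2 / ε) * Metric.infDist (π x) Z := by
    intro x
    rw [H4, map_add, map_smul, map_neg, lu, smul_eq_mul]; ring
  have hL'comp : IsCompact (H 1 '' cycle4 D E F G) := hLcomp.image (H 1).continuous
  have hL' : ∀ y ∈ H 1 '' cycle4 D E F G, l y = k → y ∈ segment ℝ D G ∪ segment ℝ F G := by
    rintro _ ⟨x, hx, rfl⟩ hy
    have hcase : x ∈ segment ℝ D E ∪ segment ℝ E F ∨ x ∈ segment ℝ D G ∪ segment ℝ F G := by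
      rcases hx with ((hx | hx) | hx) | hx
      · exact Or.inl (Or.inl hx)
      · exact Or.inl (Or.inr hx)
      · exact Or.inr (Or.inr hx)
      · rw [segment_symm] at hx; exact Or.inr (Or.inl hx)
    have hnn : 0 ≤ (2 / ε) * Metric.infDist (π x) Z :=
      mul_nonneg (by positivity) Metric.infDist_nonneg
    rw [hlH] at hy
    have hkx : k ≤ l x := by linarith
    rcases hcase with hx | hx
    · exfalso
      obtain ⟨h1, h2⟩ := hup x hx hkx
      have : (2 / ε) * ε ≤ (2 / ε) * Metric.infDist (π x) Z :=
        mul_le_mul_of_nonneg_left (hεXY _ h2) (by positivity)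
      rw [div_mul_cancel₀ _ hε.ne'] at this
      linarith
    · rw [hfixZ x (Or.inr ⟨x, ⟨hx, hkx⟩, rfl⟩)]
      exact hx
  -- second isotopy: push the triangle away inside its plane
  have hcv := convex_convexHull ℝ ({A, B, C} : Set E3)
  obtain ⟨f, c, f1, f2⟩ := sep_edge hCcomp hcv D G l k lD (fun x hx => hUC x (Or.inl hx))
  obtain ⟨g, d, g1, g2⟩ := sep_edge hCcomp hcv F G l k lF (fun x hx => hUC x (Or.inr hx))
  obtain ⟨w, w0, w1, w2, w3⟩ := exists_dir l f g
  have w2' : f w ≤ 0 := w2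
  have w3' : g w ≤ 0 := w3
  have hsub : cycle3 A B C ⊆ {x | l x = k ∧ f x ≤ c ∧ g x ≤ d} :=
    fun x hx => ⟨hull_l x (hKC hx), f1 x (hKC hx), g1 x (hKC hx)⟩
  refine SplitLink.of_push (S := {x | l x = k ∧ f x ≤ c ∧ g x ≤ d}) w w0 hKcomp hL'comp
    ?_ ⟨A, hsub hAK⟩ hsub ?_ ?_ ?_
  · exact (isClosed_eq hlc continuous_const).inter
      ((isClosed_le f.continuous continuous_const).inter
        (isClosed_le g.continuous continuous_const))
  · rintro x hx ⟨h1, h2, h3⟩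
    rcases hL' x hx h1 with h | h
    · exact absurd (f2 x h h1) (not_lt.2 h2)
    · exact absurd (g2 x h h1) (not_lt.2 h3)
  · rintro x ⟨h1, h2, h3⟩ s hs
    have i1 := mul_nonpos_of_nonneg_of_nonpos hs w2'
    have i2 := mul_nonpos_of_nonneg_of_nonpos hs w3'
    refine ⟨?_, ?_, ?_⟩
    · rw [map_add, map_smul, w1, h1]; simp
    · rw [map_add, map_smul, smul_eq_mul]; linarith
    · rw [map_add, map_smul, smul_eq_mul]; linarith
  · intro K' hK' hs
    exact SplitLink.of_sep w hK' hL'comp hs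

/-- Let a straight-edge triangle `ABC` (`A = v 0`, `B = v 1`, `C = v 2`) and a
straight-edge quadrilateral `DEFG` (`D = v 3`, `E = v 4`, `F = v 5`, `G = v 6`) be
disjoint cycles in `ℝ³` with vertices in general position.  If the boundary of
the quadrilateral meets the flat triangular disk bounded by `ABC` in exactly two
points `X` and `Y`, lying on the interiors of the adjacent edges `DE` and `EF`
respectively, then the two cycles form a trivial (split) link. -/
theorem two_adjacent_intersections_split (v : Fin 7 → E3) (X Y : E3)
    (hGP : GenPos7 v)
    (hX : X ∈ openSegment ℝ (v 3) (v 4))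
    (hY : Y ∈ openSegment ℝ (v 4) (v 5))
    (hXY : X ≠ Y)
    (hmeet : cycle4 (v 3) (v 4) (v 5) (v 6) ∩ convexHull ℝ {v 0, v 1, v 2}
      = {X, Y}) :
    SplitLink (cycle3 (v 0) (v 1) (v 2)) (cycle4 (v 3) (v 4) (v 5) (v 6)) := by
  obtain ⟨l, k, l1, l2, l3, l4⟩ := exists_plane
    (hGP 0 1 2 4 (by decide) (by decide) (by decide) (by decide) (by decide) (by decide))
  obtain ⟨p, kp, p1, p2, p3, p4⟩ := exists_plane
    (hGP 3 4 5 6 (by decide) (by decide) (by decide) (by decide) (by decide) (by decide))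
  have hXC : X ∈ convexHull ℝ {v 0, v 1, v 2} := by
    have : X ∈ ({X, Y} : Set E3) := by simp
    rw [← hmeet] at this; exact this.2
  have hYC : Y ∈ convexHull ℝ {v 0, v 1, v 2} := by
    have : Y ∈ ({X, Y} : Set E3) := by simp
    rw [← hmeet] at this; exact this.2
  have hedge : ∀ i j m : Fin 7, i ≠ j → i ≠ m → j ≠ m → i < 3 → j < 3 → m < 3 →
      ({v i, v j, v m} : Set E3) = {v 0, v 1, v 2} →
      ∀ x ∈ segment ℝ X Y, x ∉ segment ℝ (v i) (v j) := by
    intro i j m hij him hjm hi hj hm he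
    have ne : ∀ a b : Fin 7, a < 3 → 3 ≤ b → a ≠ b :=
      fun a b ha hb => ne_of_lt (lt_of_lt_of_le ha hb)
    have q3 : (3 : Fin 7) ≤ 3 := le_refl _
    have q4 : (3 : Fin 7) ≤ 4 := by decide
    have q5 : (3 : Fin 7) ≤ 5 := by decide
    exact edge_avoid
      (hGP i j 4 m hij (ne _ _ hi q4) him (ne _ _ hj q4) hjm (ne _ _ hm q4).symm)
      (hGP i j 4 3 hij (ne _ _ hi q4) (ne _ _ hi q3) (ne _ _ hj q4) (ne _ _ hj q3) (by decide))
      (hGP i j 4 5 hij (ne _ _ hi q4) (ne _ _ hi q5) (ne _ _ hj q4) (ne _ _ hj q5) (by decide))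
      hX hY (by rw [he]; exact hXC) (by rw [he]; exact hYC)
  refine split_core l p k kp l1 l2 l3 l4 p1 p2 p3 p4 hX hY ?_ hmeet
  rintro x hx ((h | h) | h)
  · exact hedge 0 1 2 (by decide) (by decide) (by decide) (by decide) (by decide) (by decide)
      rfl x hx h
  · refine hedge 1 2 0 (by decide) (by decide) (by decide) (by decide) (by decide) (by decide)
      ?_ x hx h
    ext y; simp only [Set.mem_insert_iff, Set.mem_singleton_iff]; tauto
  · refine hedge 2 0 1 (by decide) (by decide) (by decide) (by decide) (by decide) (by decide)
      ?_ x hx h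
    ext y; simp only [Set.mem_insert_iff, Set.mem_singleton_iff]; tauto

end
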